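/- Let γ > 0, λ ∈ ℂ, and let ψ : ℝ³∖{0} → ℂ be a smooth function with Tψ = λψ on ℝ³∖{0}. Suppose ψ is bounded on the punctured unit ball {x : 0 < ‖x‖ < 1}, and suppose ψ is K-finite: the complex linear span of the rotated functions {x ↦ ψ(A⁻¹x) : A ∈ SO(3)} is a finite-dimensional vector space. Then for each i ∈ {1,2,3} there is δ > 0 such that the function Rᵢψ is bounded on {x : 0 < ‖x‖ < δ}; that is, the Runge–Lenz operators preserve the space of K-finite eigenfunctions of T that are bounded near the origin. -/

import Mathlib

noncomputable section

/-- Euclidean 3-space. -/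
abbrev E3 : Type := EuclideanSpace ℝ (Fin 3)

/-- The `i`-th partial derivative of a complex-valued function on `E3`. -/
def pd (i : Fin 3) (f : E3 → ℂ) (x : E3) : ℂ :=
  fderiv ℝ f x (EuclideanSpace.single i 1)

/-- Angular momentum operator `L₁ = x₂∂₃ − x₃∂₂` (0-indexed coordinates). -/
def L1 (f : E3 → ℂ) (x : E3) : ℂ := (x 1 : ℂ) * pd 2 f x - (x 2 : ℂ) * pd 1 f x

/-- Angular momentum operator `L₂ = x₃∂₁ − x₁∂₃`. -/
def L2 (f : E3 → ℂ) (x : E3) : ℂ := (x 2 : ℂ) * pd 0 f x - (x 0 : ℂ) * pd 2 f x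

/-- Angular momentum operator `L₃ = x₁∂₂ − x₂∂₁`. -/
def L3 (f : E3 → ℂ) (x : E3) : ℂ := (x 0 : ℂ) * pd 1 f x - (x 1 : ℂ) * pd 0 f x

/-- Runge–Lenz operator `R₁ = i(L₃∂₂ − L₂∂₃ − ∂₁ + γx₁/r)`. -/
def R1 (γ : ℝ) (f : E3 → ℂ) (x : E3) : ℂ :=
  Complex.I * (L3 (pd 1 f) x - L2 (pd 2 f) x - pd 0 f x + ((γ * x 0 / ‖x‖ : ℝ) : ℂ) * f x)

/-- Runge–Lenz operator `R₂ = i(L₁∂₃ − L₃∂₁ − ∂₂ + γx₂/r)`. -/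
def R2 (γ : ℝ) (f : E3 → ℂ) (x : E3) : ℂ :=
  Complex.I * (L1 (pd 2 f) x - L3 (pd 0 f) x - pd 1 f x + ((γ * x 1 / ‖x‖ : ℝ) : ℂ) * f x)

/-- Runge–Lenz operator `R₃ = i(L₂∂₁ − L₁∂₂ − ∂₃ + γx₃/r)`. -/
def R3 (γ : ℝ) (f : E3 → ℂ) (x : E3) : ℂ :=
  Complex.I * (L2 (pd 0 f) x - L1 (pd 1 f) x - pd 2 f x + ((γ * x 2 / ‖x‖ : ℝ) : ℂ) * f x)

/-- The rescaled Schrödinger operator `T = −Δ − 2γ/r`. -/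
def Tsch (γ : ℝ) (f : E3 → ℂ) (x : E3) : ℂ :=
  -(pd 0 (pd 0 f) x + pd 1 (pd 1 f) x + pd 2 (pd 2 f) x) - ((2 * γ / ‖x‖ : ℝ) : ℂ) * f x

/-- The function `x ↦ ψ(A⁻¹x)` obtained by rotating `ψ` by the matrix `A`. -/
def rotate (A : Matrix (Fin 3) (Fin 3) ℝ) (ψ : E3 → ℂ) : E3 → ℂ :=
  fun x => ψ ((EuclideanSpace.equiv (Fin 3) ℝ).symm
    (A⁻¹.mulVec (EuclideanSpace.equiv (Fin 3) ℝ x)))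

lemma hasDerivAt_ofReal_pow_succ (n : ℕ) (r : ℝ) :
    HasDerivAt (fun s : ℝ => (s : ℂ) ^ (n + 1)) ((n + 1) * (r : ℂ) ^ n) r := by
  have hid : HasDerivAt (fun s : ℝ => (s : ℂ)) 1 r := Complex.ofRealCLM.hasDerivAt
  simpa using hid.fun_pow (n + 1)

/-- If `s^(n+1) u` is differentiable with derivative `s^n v` and `u` is bounded near zero, then any
bound of `v` is a bound of `u`. -/
lemma norm_le_of_hasDerivAt_pow_mul {n : ℕ} {u v : ℝ → ℂ} {r b M : ℝ} (hr : 0 < r)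
    (hu : ∀ s, 0 < s → s ≤ r → HasDerivAt (fun s : ℝ => (s : ℂ) ^ (n + 1) * u s)
      ((s : ℂ) ^ n * v s) s)
    (hM : ∀ s, 0 < s → s ≤ r → ‖u s‖ ≤ M)
    (hv : ∀ s, 0 < s → s ≤ r → ‖v s‖ ≤ b) : ‖u r‖ ≤ b := by
  have hb : 0 ≤ b := (norm_nonneg _).trans (hv r hr le_rfl)
  have key : ∀ ε, 0 < ε → ε < r → r ^ (n + 1) * ‖u r‖ ≤ ε ^ (n + 1) * M + r ^ (n + 1) * b := by
    intro ε hε hεr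
    have h2 := (convex_Icc ε r).norm_image_sub_le_of_norm_hasDerivWithin_le
      (f := fun s : ℝ => (s : ℂ) ^ (n + 1) * u s) (f' := fun s => (s : ℂ) ^ n * v s)
      (C := r ^ n * b) (x := ε) (y := r)
      (fun s hs => (hu s (hε.trans_le hs.1) hs.2).hasDerivWithinAt)
      (fun s hs => by
        have hs0 := hε.trans_le hs.1
        rw [norm_mul, norm_pow, Complex.norm_real, Real.norm_of_nonneg hs0.le]
        exact mul_le_mul (pow_le_pow_left₀ hs0.le hs.2 n) (hv s hs0 hs.2) (norm_nonneg _)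
          (by positivity)) (by simp [hεr.le]) (by simp [hεr.le])
    have e1 : ‖(r : ℂ) ^ (n + 1) * u r‖ = r ^ (n + 1) * ‖u r‖ := by
      rw [norm_mul, norm_pow, Complex.norm_real, Real.norm_of_nonneg hr.le]
    have e2 : ‖(ε : ℂ) ^ (n + 1) * u ε‖ ≤ ε ^ (n + 1) * M := by
      rw [norm_mul, norm_pow, Complex.norm_real, Real.norm_of_nonneg hε.le]
      exact mul_le_mul_of_nonneg_left (hM ε hε hεr.le) (by positivity)
    have e3 := norm_sub_norm_le ((r : ℂ) ^ (n + 1) * u r) ((ε : ℂ) ^ (n + 1) * u ε)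
    rw [Real.norm_of_nonneg (by linarith : (0 : ℝ) ≤ r - ε)] at h2
    have e4 : r ^ n * b * (r - ε) ≤ r ^ (n + 1) * b := by
      have : r ^ n * b * (r - ε) ≤ r ^ n * b * r :=
        mul_le_mul_of_nonneg_left (by linarith) (by positivity)
      calc _ ≤ _ := this
        _ = _ := by ring
    linarith
  have hlim : Filter.Tendsto (fun ε : ℝ => ε ^ (n + 1) * M + r ^ (n + 1) * b)
      (nhdsWithin 0 (Set.Ioi 0)) (nhds (r ^ (n + 1) * b)) := by
    have : Continuous (fun ε : ℝ => ε ^ (n + 1) * M + r ^ (n + 1) * b) := by fun_prop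
    have h := this.tendsto 0
    simp only [ne_eq, Nat.add_eq_zero_iff, one_ne_zero, and_false, not_false_eq_true, zero_pow,
      zero_mul, zero_add] at h
    exact h.mono_left nhdsWithin_le_nhds
  have := ge_of_tendsto hlim (b := r ^ (n + 1) * ‖u r‖) (by
    filter_upwards [Ioo_mem_nhdsGT hr] with ε hε using key ε hε.1 hε.2)
  exact le_of_mul_le_mul_left this (by positivity)

/-- Backward integration of an inverse-square-root bound on a derivative. -/
lemma norm_le_add_of_norm_deriv_le_inv_sqrt {g g' : ℝ → ℂ} {r A : ℝ} (hr : 0 < r)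
    (hr2 : r ≤ 1 / 2) (hA : 0 ≤ A)
    (hg : ∀ s, 0 < s → HasDerivAt g (g' s) s)
    (hb : ∀ s, r ≤ s → s ≤ 1 / 2 → ‖g' s‖ ≤ A / √s) :
    ‖g r‖ ≤ ‖g (1 / 2)‖ + 2 * A := by
  have h := image_norm_le_of_norm_deriv_right_le_deriv_boundary'
    (f := fun s => g s - g r) (f' := g') (a := r) (b := 1 / 2)
    (B := fun s => 2 * A * (√s - √r)) (B' := fun s => A / √s)
    (fun s hs => ((hg s (hr.trans_le hs.1)).sub_const _).continuousAt.continuousWithinAt)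
    (fun s hs => ((hg s (hr.trans_le hs.1)).sub_const _).hasDerivWithinAt)
    (by simp) (by fun_prop)
    (fun s hs => by
      have hs0 := hr.trans_le hs.1
      have := ((Real.hasDerivAt_sqrt hs0.ne').sub_const (√r)).const_mul (2 * A)
      refine (this.congr_deriv ?_).hasDerivWithinAt
      have : 0 < √s := Real.sqrt_pos.2 hs0
      field_simp)
    (fun s hs => hb s hs.1 hs.2.le) (x := 1 / 2) ⟨hr2, le_rfl⟩
  have h1 : √(1 / 2 : ℝ) ≤ 1 := Real.sqrt_le_one.2 (by norm_num)
  have h2 : 2 * A * (√(1 / 2) - √r) ≤ 2 * A := by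
    have := Real.sqrt_nonneg r
    nlinarith
  have h3 := norm_sub_norm_le (g r) (g (1 / 2))
  rw [norm_sub_rev] at h
  linarith

section Radial

variable {l : ℕ} {γ : ℝ} {lam : ℂ} {h h' h'' : ℝ → ℂ}

lemma hasDerivAt_radial_lower (h0 : ∀ r, 0 < r → HasDerivAt h (h' r) r)
    (h1 : ∀ r, 0 < r → HasDerivAt h' (h'' r) r)
    (hode : ∀ r : ℝ, 0 < r → (r : ℂ) ^ 2 * h'' r + 2 * r * h' r
      = (l * (l + 1) - 2 * γ * r - lam * r ^ 2) * h r) {r : ℝ} (hr : 0 < r) :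
    HasDerivAt (fun s : ℝ => (s : ℂ) * h' s + (l + 1) * h s)
      (l * ((r : ℂ) * h' r + (l + 1) * h r) / r - (2 * γ + lam * r) * h r) r := by
  have hid : HasDerivAt (fun s : ℝ => (s : ℂ)) 1 r := Complex.ofRealCLM.hasDerivAt
  refine ((hid.mul (h1 r hr)).add ((h0 r hr).const_mul _)).congr_deriv ?_
  have hr' : (r : ℂ) ≠ 0 := by exact_mod_cast hr.ne'
  field_simp
  linear_combination hode r hr

lemma hasDerivAt_pow_mul_radial (h0 : ∀ r, 0 < r → HasDerivAt h (h' r) r) (n : ℕ) (c : ℂ)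
    {r : ℝ} (hr : 0 < r) :
    HasDerivAt (fun s : ℝ => (s : ℂ) ^ (n + 1) * (h s - c))
      ((r : ℂ) ^ n * ((r : ℂ) * h' r + (n + 1) * h r - (n + 1) * c)) r := by
  refine ((hasDerivAt_ofReal_pow_succ n r).mul ((h0 r hr).sub_const c)).congr_deriv ?_
  ring

lemma norm_potential_le {M : ℝ} (hγ : 0 < γ) {r : ℝ} (hr : 0 < r) (hr1 : r ≤ 1) {z : ℂ}
    (hz : ‖z‖ ≤ M) : ‖(2 * γ + lam * r) * z‖ ≤ (2 * γ + ‖lam‖) * M := by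
  rw [norm_mul]
  refine mul_le_mul ?_ hz (norm_nonneg _) (by positivity)
  refine (norm_add_le _ _).trans ?_
  simp only [norm_mul, Complex.norm_real, Complex.norm_ofNat, Real.norm_of_nonneg hr.le,
    Real.norm_of_nonneg hγ.le]
  have := norm_nonneg lam
  nlinarith

/-- For angular momentum zero, a bounded solution of the radial equation has bounded derivative. -/
lemma norm_deriv_radial_zero_le {M : ℝ} (hγ : 0 < γ) (h0 : ∀ r, 0 < r → HasDerivAt h (h' r) r)
    (h1 : ∀ r, 0 < r → HasDerivAt h' (h'' r) r)
    (hode : ∀ r : ℝ, 0 < r → (r : ℂ) ^ 2 * h'' r + 2 * r * h' r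
      = (((0 : ℕ) : ℂ) * ((0 : ℕ) + 1) - 2 * γ * r - lam * r ^ 2) * h r)
    (hM : ∀ r, 0 < r → r < 1 → ‖h r‖ ≤ M) {r : ℝ} (hr : 0 < r) (hr2 : r ≤ 1 / 2) :
    ‖h' r‖ ≤ (2 * γ + ‖lam‖) * M := by
  set Q := (2 * γ + ‖lam‖) * M
  set w : ℝ → ℂ := fun s => (s : ℂ) * h' s + ((0 : ℕ) + 1) * h s with hw
  have hQ : 0 ≤ Q := (norm_nonneg _).trans
    (norm_potential_le hγ hr (by linarith) (hM r hr (by linarith)) (lam := lam))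
  have hw' : ∀ s, 0 < s → s ≤ r → ‖w s - w r‖ ≤ Q * r := by
    intro s hs hsr
    have := (convex_Icc s r).norm_image_sub_le_of_norm_hasDerivWithin_le (f := w)
      (C := Q) (x := r) (y := s)
      (fun t ht => (hasDerivAt_radial_lower h0 h1 hode (hs.trans_le ht.1)).hasDerivWithinAt)
      (fun t ht => by
        have ht0 := hs.trans_le ht.1
        simp only [Nat.cast_zero, zero_mul, zero_div, zero_sub, norm_neg]
        exact norm_potential_le hγ ht0 (by linarith [ht.2]) (hM t ht0 (by linarith [ht.2])))
      (by simp [hsr]) (by simp [hsr])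
    refine this.trans (mul_le_mul_of_nonneg_left ?_ hQ)
    rw [Real.norm_eq_abs, abs_le]
    constructor <;> linarith
  have := norm_le_of_hasDerivAt_pow_mul (n := 0) (u := fun s => h s - w r)
    (v := fun s => w s - w r) (b := Q * r) (M := M + ‖w r‖) hr
    (fun s hs hsr => (hasDerivAt_pow_mul_radial h0 0 (w r) hs).congr_deriv (by simp [hw]))
    (fun s hs hsr => (norm_sub_le _ _).trans (by
      gcongr
      exact hM s hs (by linarith))) hw'
  have e : h r - w r = -((r : ℂ) * h' r) := by simp [hw]
  simp only [e, norm_neg, norm_mul, Complex.norm_real, Real.norm_of_nonneg hr.le] at this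
  rw [mul_comm Q] at this
  exact le_of_mul_le_mul_left this hr

/-- Backward integration of the first-order equation satisfied by `r ∂h + (n + 2) h`. -/
lemma norm_radial_lower_le {n : ℕ} (h0 : ∀ r, 0 < r → HasDerivAt h (h' r) r)
    (h1 : ∀ r, 0 < r → HasDerivAt h' (h'' r) r)
    (hode : ∀ r : ℝ, 0 < r → (r : ℂ) ^ 2 * h'' r + 2 * r * h' r
      = (((n + 1 : ℕ) : ℂ) * ((n + 1 : ℕ) + 1) - 2 * γ * r - lam * r ^ 2) * h r)
    {r A : ℝ} (hr : 0 < r) (hr2 : r ≤ 1 / 2) (hA : 0 ≤ A)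
    (hb : ∀ s, r ≤ s → s ≤ 1 / 2 → ‖(2 * γ + lam * s) * h s‖ ≤ A * √s) :
    ‖(r : ℂ) * h' r + ((n + 1 : ℕ) + 1) * h r‖
      ≤ 2 * r * ‖((1 / 2 : ℝ) : ℂ) * h' (1 / 2) + ((n + 1 : ℕ) + 1) * h (1 / 2)‖
        + 2 * A * r := by
  set w : ℝ → ℂ := fun s => (s : ℂ) * h' s + ((n + 1 : ℕ) + 1) * h s with hw
  have hd : ∀ s : ℝ, 0 < s → HasDerivAt (fun s : ℝ => w s / (s : ℂ) ^ (n + 1))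
      (-((2 * γ + lam * s) * h s) / (s : ℂ) ^ (n + 1)) s := by
    intro s hs
    have hs' : (s : ℂ) ≠ 0 := by exact_mod_cast hs.ne'
    refine ((hasDerivAt_radial_lower h0 h1 hode hs).div (hasDerivAt_ofReal_pow_succ n s)
      (pow_ne_zero _ hs')).congr_deriv ?_
    push_cast
    field_simp
    ring
  have hrn : 0 < r ^ n := by positivity
  have := norm_le_add_of_norm_deriv_le_inv_sqrt (g := fun s : ℝ => w s / (s : ℂ) ^ (n + 1))
    (A := A / r ^ n) hr hr2 (by positivity) hd (fun s hs hs2 => by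
      have hs0 := hr.trans_le hs
      rw [norm_div, norm_neg, norm_pow, Complex.norm_real, Real.norm_of_nonneg hs0.le]
      have hsq : 0 < √s := Real.sqrt_pos.2 hs0
      have e : A / r ^ n / √s = A * √s / (r ^ n * s) := by
        nth_rewrite 3 [← Real.mul_self_sqrt hs0.le]
        field_simp
      rw [e]
      refine div_le_div₀ (by positivity) (hb s hs hs2) (by positivity) ?_
      rw [pow_succ]
      gcongr)
  simp only [norm_div, norm_pow, Complex.norm_real, Real.norm_of_nonneg hr.le] at this
  rw [div_le_iff₀ (by positivity)] at this
  rw [norm_one, Real.norm_ofNat] at this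
  refine this.trans ?_
  rw [add_mul]
  refine add_le_add ?_ (le_of_eq ?_)
  · have h2r : (2 * r) ^ (n + 1) ≤ 2 * r :=
      pow_le_of_le_one (by positivity) (by linarith) (by simp)
    calc ‖w (1 / 2)‖ / (1 / 2) ^ (n + 1) * r ^ (n + 1)
        = (2 * r) ^ (n + 1) * ‖w (1 / 2)‖ := by
          rw [mul_pow, one_div_pow]; field_simp
      _ ≤ _ := by gcongr
  · field_simp
    ring

/-- For positive angular momentum, a bounded solution of the radial equation is `O(r)`,
with bounded derivative. -/
lemma norm_radial_succ_le {n : ℕ} {M W : ℝ} (hγ : 0 < γ)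
    (h0 : ∀ r, 0 < r → HasDerivAt h (h' r) r)
    (h1 : ∀ r, 0 < r → HasDerivAt h' (h'' r) r)
    (hode : ∀ r : ℝ, 0 < r → (r : ℂ) ^ 2 * h'' r + 2 * r * h' r
      = (((n + 1 : ℕ) : ℂ) * ((n + 1 : ℕ) + 1) - 2 * γ * r - lam * r ^ 2) * h r)
    (hM : ∀ r, 0 < r → r < 1 → ‖h r‖ ≤ M)
    (hW : ‖((1 / 2 : ℝ) : ℂ) * h' (1 / 2) + ((n + 1 : ℕ) + 1) * h (1 / 2)‖ ≤ W)
    {P K₁ K₂ : ℝ} (hP : P = 2 * γ + ‖lam‖) (hK₁ : K₁ = 2 * W + 2 * (P * M))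
    (hK₂ : K₂ = 2 * W + 2 * (P * K₁)) {r : ℝ} (hr : 0 < r) (hr2 : r ≤ 1 / 2) :
    ‖h r‖ ≤ K₂ * r ∧ ‖h' r‖ ≤ (n + 3) * K₂ := by
  set w : ℝ → ℂ := fun s => (s : ℂ) * h' s + ((n + 1 : ℕ) + 1) * h s with hw
  have hM0 : 0 ≤ M := (norm_nonneg _).trans (hM r hr (by linarith))
  have hW0 : 0 ≤ W := (norm_nonneg _).trans hW
  have hP0 : 0 ≤ P := by rw [hP]; positivity
  have hK10 : 0 ≤ K₁ := by rw [hK₁]; positivity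
  have hK20 : 0 ≤ K₂ := by rw [hK₂]; positivity
  have transfer : ∀ b : ℝ → ℝ, Monotone b →
      (∀ s, 0 < s → s ≤ 1 / 2 → ‖w s‖ ≤ b s) → ∀ s, 0 < s → s ≤ 1 / 2 → ‖h s‖ ≤ b s := by
    intro b hb hwb s hs hs2
    refine norm_le_of_hasDerivAt_pow_mul (n := n + 1) (u := h) (v := w) (M := M) hs
      (fun t ht _ => ?_) (fun t ht hts => hM t ht (by linarith))
      (fun t ht hts => (hwb t ht (by linarith)).trans (hb hts))
    simpa [hw] using hasDerivAt_pow_mul_radial h0 (n + 1) 0 ht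
  have w1 : ∀ s, 0 < s → s ≤ 1 / 2 → ‖w s‖ ≤ K₁ * √s := by
    intro s hs hs2
    have hsq : 0 < √s := Real.sqrt_pos.2 hs
    have hss : √s * √s = s := Real.mul_self_sqrt hs.le
    have hs1 : √s ≤ 1 := Real.sqrt_le_one.2 (by linarith)
    have := norm_radial_lower_le h0 h1 hode (A := P * M / √s) hs hs2 (by positivity)
      (fun t ht ht2 => by
        have ht0 := hs.trans_le ht
        have hp := norm_potential_le (lam := lam) hγ ht0 (by linarith) (hM t ht0 (by linarith))
        rw [← hP] at hp
        refine hp.trans ?_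
        rw [div_mul_eq_mul_div, le_div_iff₀ hsq]
        gcongr)
    refine this.trans ?_
    have e : 2 * (P * M / √s) * s = 2 * (P * M) * √s := by
      nth_rewrite 2 [← hss]
      field_simp
    rw [e, hK₁, add_mul (2 * W)]
    refine add_le_add ?_ le_rfl
    calc 2 * s * _ ≤ 2 * s * W := by gcongr
      _ ≤ 2 * √s * W := by gcongr; nlinarith
      _ = _ := by ring
  have b1 := transfer (fun s => K₁ * √s) (fun a b hab => by
    simp only; gcongr) w1
  have w2 : ∀ s, 0 < s → s ≤ 1 / 2 → ‖w s‖ ≤ K₂ * s := by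
    intro s hs hs2
    have := norm_radial_lower_le h0 h1 hode (A := P * K₁) hs hs2 (by positivity)
      (fun t ht ht2 => by
        have ht0 := hs.trans_le ht
        have hp := norm_potential_le (lam := lam) hγ ht0 (by linarith) (b1 t ht0 ht2)
        rw [← hP] at hp
        refine hp.trans (le_of_eq (by ring)))
    refine this.trans ?_
    rw [hK₂, add_mul (2 * W)]
    refine add_le_add ?_ le_rfl
    calc 2 * s * _ ≤ 2 * s * W := by gcongr
      _ = _ := by ring
  have b2 := transfer (fun s => K₂ * s) (fun a b hab => by simp only; gcongr) w2
  refine ⟨b2 r hr hr2, ?_⟩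
  have e : (r : ℂ) * h' r = w r - ((n + 1 : ℕ) + 1) * h r := by simp [hw]
  have hn : ‖(((n + 1 : ℕ) : ℂ) + 1)‖ = n + 2 := by
    have : (((n + 1 : ℕ) : ℂ) + 1) = ((n + 2 : ℕ) : ℂ) := by push_cast; ring
    rw [this, Complex.norm_natCast]
    push_cast
    ring
  have h3 : r * ‖h' r‖ ≤ r * ((n + 3) * K₂) := by
    have := norm_sub_le (w r) (((n + 1 : ℕ) + 1) * h r)
    rw [← e, norm_mul, norm_mul, hn, Complex.norm_real, Real.norm_of_nonneg hr.le] at this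
    have h4 := w2 r hr hr2
    have h5 : ((n : ℝ) + 2) * ‖h r‖ ≤ (n + 2) * (K₂ * r) := by
      gcongr
      exact b2 r hr hr2
    nlinarith
  exact le_of_mul_le_mul_left h3 hr

end Radial

section Calculus

/-- The angular momentum operators, indexed cyclically. -/
def ang (k : Fin 3) (f : E3 → ℂ) (x : E3) : ℂ :=
  (x (k + 1) : ℂ) * pd (k + 2) f x - (x (k + 2) : ℂ) * pd (k + 1) f x

/-- Smoothness on the punctured space. -/
abbrev SmoothOff (f : E3 → ℂ) : Prop := ContDiffOn ℝ (⊤ : ℕ∞) f {x : E3 | x ≠ 0}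

variable {f g : E3 → ℂ} {x : E3}

lemma SmoothOff.contDiffAt (hf : SmoothOff f) (hx : x ≠ 0) : ContDiffAt ℝ (⊤ : ℕ∞) f x :=
  ContDiffOn.contDiffAt hf (isOpen_ne.mem_nhds hx)

lemma SmoothOff.differentiableAt (hf : SmoothOff f) (hx : x ≠ 0) : DifferentiableAt ℝ f x :=
  (hf.contDiffAt hx).differentiableAt (by simp)

lemma smoothOff_of_contDiffAt (h : ∀ x, x ≠ 0 → ContDiffAt ℝ (⊤ : ℕ∞) f x) : SmoothOff f :=
  fun x hx => (h x hx).contDiffWithinAt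

lemma SmoothOff.contDiffAt_fderiv (hf : SmoothOff f) (hx : x ≠ 0) :
    ContDiffAt ℝ (⊤ : ℕ∞) (fderiv ℝ f) x :=
  (hf.contDiffAt hx).fderiv_right (by simp)

lemma SmoothOff.pd (hf : SmoothOff f) (i : Fin 3) : SmoothOff (pd i f) :=
  smoothOff_of_contDiffAt fun _ hx => (hf.contDiffAt_fderiv hx).clm_apply contDiffAt_const

lemma contDiff_coord (a : Fin 3) : ContDiff ℝ (⊤ : ℕ∞) (fun y : E3 => (y a : ℂ)) :=
  Complex.ofRealCLM.contDiff.comp (EuclideanSpace.proj a : E3 →L[ℝ] ℝ).contDiff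

lemma SmoothOff.ang (hf : SmoothOff f) (k : Fin 3) : SmoothOff (ang k f) :=
  ((contDiff_coord _).contDiffOn.mul (hf.pd _)).sub ((contDiff_coord _).contDiffOn.mul (hf.pd _))

lemma pd_pd_eq (hf : SmoothOff f) (hx : x ≠ 0) (i j : Fin 3) :
    pd i (pd j f) x = fderiv ℝ (fderiv ℝ f) x (EuclideanSpace.single i 1)
      (EuclideanSpace.single j 1) := by
  have hd : DifferentiableAt ℝ (fderiv ℝ f) x :=
    (hf.contDiffAt_fderiv hx).differentiableAt (by simp)
  have := (hd.hasFDerivAt.clm_apply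
    (hasFDerivAt_const (EuclideanSpace.single j 1 : E3) x)).fderiv
  unfold pd
  rw [this]
  simp

lemma pd_comm (hf : SmoothOff f) (hx : x ≠ 0) (i j : Fin 3) :
    pd i (pd j f) x = pd j (pd i f) x := by
  rw [pd_pd_eq hf hx, pd_pd_eq hf hx]
  exact ((hf.contDiffAt hx).isSymmSndFDerivAt
    (by simpa using WithTop.coe_le_coe.2 (le_top : (2 : ℕ∞) ≤ ⊤))).eq _ _

lemma pd_coord_mul (hg : DifferentiableAt ℝ g x) (i a : Fin 3) :
    pd i (fun y => (y a : ℂ) * g y) x = (if a = i then 1 else 0) * g x + x a * pd i g x := by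
  have hc : HasFDerivAt (fun y : E3 => (y a : ℂ))
      (Complex.ofRealCLM.comp (EuclideanSpace.proj a : E3 →L[ℝ] ℝ)) x :=
    (Complex.ofRealCLM.comp (EuclideanSpace.proj a : E3 →L[ℝ] ℝ)).hasFDerivAt
  unfold pd
  rw [(hc.fun_mul hg.hasFDerivAt).fderiv]
  simp only [add_apply, smul_apply, ContinuousLinearMap.coe_comp, Function.comp_apply,
    smul_eq_mul]
  simp
  split_ifs
  · simp
    ring
  · simp

lemma pd_ang (hf : SmoothOff f) (hx : x ≠ 0) (i k : Fin 3) :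
    pd i (ang k f) x =
      ((if k + 1 = i then 1 else 0) * pd (k + 2) f x + x (k + 1) * pd i (pd (k + 2) f) x)
      - ((if k + 2 = i then 1 else 0) * pd (k + 1) f x + x (k + 2) * pd i (pd (k + 1) f) x) := by
  have h1 := (hf.pd (k + 2)).differentiableAt hx
  have h2 := (hf.pd (k + 1)).differentiableAt hx
  have hc : ∀ a : Fin 3, DifferentiableAt ℝ (fun y : E3 => (y a : ℂ)) x :=
    fun a => (contDiff_coord a).contDiffAt.differentiableAt (by simp)
  rw [← pd_coord_mul h1, ← pd_coord_mul h2]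
  have := fderiv_fun_sub ((hc (k + 1)).mul h1) ((hc (k + 2)).mul h2)
  exact congrArg (fun L : E3 →L[ℝ] ℂ => L (EuclideanSpace.single i 1)) this

lemma fin3_add : (1 : Fin 3) + 1 = 2 ∧ (1 : Fin 3) + 2 = 0 ∧ (2 : Fin 3) + 1 = 0 ∧
    (2 : Fin 3) + 2 = 1 := by decide

lemma ang_commutator (hf : SmoothOff f) (k : Fin 3) :
    ang k (ang (k + 1) f) x - ang (k + 1) (ang k f) x = -ang (k + 2) f x := by
  rcases eq_or_ne x 0 with rfl | hx
  · simp [ang]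
  · obtain ⟨e1, e2, e3, e4⟩ := fin3_add
    have h01 := pd_comm hf hx 1 0
    have h02 := pd_comm hf hx 2 0
    have h12 := pd_comm hf hx 2 1
    obtain rfl | rfl | rfl : k = 0 ∨ k = 1 ∨ k = 2 := by lia
    all_goals
      rw [ang, ang.eq_1 _ (ang _ f)]
      simp only [pd_ang hf hx]
      simp [ang, e1, e2, e3, e4, h01, h02, h12]
      ring

lemma sum_ang_ang (hf : SmoothOff f) (hx : x ≠ 0) :
    ∑ k, ang k (ang k f) x = (‖x‖ : ℂ) ^ 2 * ∑ i, pd i (pd i f) x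
      - ∑ i, ∑ j, (x i : ℂ) * x j * pd i (pd j f) x - 2 * ∑ i, (x i : ℂ) * pd i f x := by
  obtain ⟨e1, e2, e3, e4⟩ := fin3_add
  have h01 := pd_comm hf hx 1 0
  have h02 := pd_comm hf hx 2 0
  have h12 := pd_comm hf hx 2 1
  have hn : (‖x‖ : ℂ) ^ 2 = (x 0 : ℂ) ^ 2 + (x 1 : ℂ) ^ 2 + (x 2 : ℂ) ^ 2 := by
    have := EuclideanSpace.real_norm_sq_eq x
    rw [Fin.sum_univ_three] at this
    exact_mod_cast this
  rw [hn]
  simp only [Fin.sum_univ_three]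
  rw [ang, ang.eq_1 1 (ang _ f), ang.eq_1 2 (ang _ f)]
  simp only [pd_ang hf hx]
  simp [e1, e2, e3, e4, h01, h02, h12]
  ring

lemma ang_pd (hf : SmoothOff f) (hx : x ≠ 0) (i k : Fin 3) :
    ang k (pd i f) x = pd i (ang k f) x
      - ((if k + 1 = i then 1 else 0) * pd (k + 2) f x
        - (if k + 2 = i then 1 else 0) * pd (k + 1) f x) := by
  rw [pd_ang hf hx, ang, pd_comm hf hx (k + 2) i, pd_comm hf hx (k + 1) i]
  ring

lemma norm_sq_mul_pd (i : Fin 3) : (‖x‖ : ℂ) ^ 2 * pd i f x =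
    x i * (∑ j, (x j : ℂ) * pd j f x)
      + (x (i + 2) * ang (i + 1) f x - x (i + 1) * ang (i + 2) f x) := by
  obtain ⟨e1, e2, e3, e4⟩ := fin3_add
  have hn : (‖x‖ : ℂ) ^ 2 = (x 0 : ℂ) ^ 2 + (x 1 : ℂ) ^ 2 + (x 2 : ℂ) ^ 2 := by
    have := EuclideanSpace.real_norm_sq_eq x
    rw [Fin.sum_univ_three] at this
    exact_mod_cast this
  rw [hn]
  simp only [Fin.sum_univ_three]
  obtain rfl | rfl | rfl : i = 0 ∨ i = 1 ∨ i = 2 := by lia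
  all_goals
    simp [ang, e1, e2, e3, e4]
    ring

lemma fderiv_apply_eq_sum (v : E3) : fderiv ℝ f x v = ∑ i, (v i : ℂ) * pd i f x := by
  conv_lhs => rw [← (EuclideanSpace.basisFun (Fin 3) ℝ).sum_repr v]
  simp [pd]

lemma hasDerivAt_comp_curve (hf : SmoothOff f) {c : ℝ → E3} {v : E3} {t : ℝ}
    (hc : HasDerivAt c v t) (h0 : c t ≠ 0) :
    HasDerivAt (fun s => f (c s)) (∑ i, (v i : ℂ) * pd i f (c t)) t := by
  rw [← fderiv_apply_eq_sum]
  exact (hf.differentiableAt h0).hasFDerivAt.comp_hasDerivAt t hc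

lemma SmoothOff.comp_isometry (hf : SmoothOff f) (e : E3 ≃ₗᵢ[ℝ] E3) : SmoothOff (f ∘ e) :=
  ContDiffOn.comp hf e.contDiff.contDiffOn fun _ hx => by simpa using hx

lemma laplacian_comp_isometry (hf : SmoothOff f) (e : E3 ≃ₗᵢ[ℝ] E3) (hx : x ≠ 0) :
    ∑ i, pd i (pd i (f ∘ e)) x = ∑ i, pd i (pd i f) (e x) := by
  have hex : e x ≠ 0 := by simpa using hx
  have h : ∀ g : E3 → ℂ, SmoothOff g → ∀ y : E3, y ≠ 0 →
      ∑ i, pd i (pd i g) y = Laplacian.laplacian g y := by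
    intro g hg y hy
    rw [InnerProductSpace.laplacian_eq_iteratedFDeriv_orthonormalBasis g
      (EuclideanSpace.basisFun (Fin 3) ℝ)]
    refine Finset.sum_congr rfl fun i _ => ?_
    rw [pd_pd_eq hg hy, iteratedFDeriv_two_apply]
    simp
  rw [h _ (hf.comp_isometry e) x hx, h f hf _ hex,
    InnerProductSpace.laplacian_eq_iteratedFDeriv_orthonormalBasis f
      ((EuclideanSpace.basisFun (Fin 3) ℝ).map e),
    InnerProductSpace.laplacian_eq_iteratedFDeriv_orthonormalBasis (f ∘ e)
      (EuclideanSpace.basisFun (Fin 3) ℝ)]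
  have := e.toContinuousLinearEquiv.iteratedFDerivWithin_comp_right (𝕜 := ℝ) f
    (s := Set.univ) uniqueDiffOn_univ (x := x) (Set.mem_univ _) 2
  simp only [Set.preimage_univ, iteratedFDerivWithin_univ] at this
  refine Finset.sum_congr rfl fun i _ => ?_
  erw [this]
  rw [ContinuousMultilinearMap.compContinuousLinearMap_apply]
  congr 1
  ext j
  fin_cases j <;> simp

end Calculus

section Rotations

open Matrix

/-- The isometry of Euclidean space given by an orthogonal matrix. -/
def orthIso (A : Matrix (Fin 3) (Fin 3) ℝ) (hA : A * Aᵀ = 1) : E3 ≃ₗᵢ[ℝ] E3 :=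
  Unitary.linearIsometryEquiv ⟨Matrix.toEuclideanCLM (n := Fin 3) (𝕜 := ℝ) A,
    Unitary.map_mem _ (Matrix.mem_unitaryGroup_iff.2 hA)⟩

lemma orthIso_apply (A : Matrix (Fin 3) (Fin 3) ℝ) (hA : A * Aᵀ = 1) (x : E3) :
    orthIso A hA x = WithLp.toLp 2 (A *ᵥ x.ofLp) := rfl

/-- The matrix of the rotation by the angle `t` about the `k`-th axis. -/
def rotMat (k : Fin 3) (t : ℝ) : Matrix (Fin 3) (Fin 3) ℝ := Matrix.of fun i j =>
  if i = k then (if j = k then 1 else 0)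
  else if i = k + 1 then
    (if j = k then 0 else if j = k + 1 then Real.cos t else -Real.sin t)
  else (if j = k then 0 else if j = k + 1 then Real.sin t else Real.cos t)

lemma rotMat_orth (k : Fin 3) (t : ℝ) : rotMat k t * (rotMat k t)ᵀ = 1 := by
  have h := Real.sin_sq_add_cos_sq t
  obtain rfl | rfl | rfl : k = 0 ∨ k = 1 ∨ k = 2 := by lia
  all_goals
    ext i j
    fin_cases i <;> fin_cases j <;>
      simp [rotMat, Matrix.mul_apply, Fin.sum_univ_three, fin3_add] <;> linarith

lemma rotMat_det (k : Fin 3) (t : ℝ) : (rotMat k t).det = 1 := by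
  have h := Real.sin_sq_add_cos_sq t
  obtain rfl | rfl | rfl : k = 0 ∨ k = 1 ∨ k = 2 := by lia
  all_goals
    simp [rotMat, Matrix.det_fin_three, fin3_add]
    linarith

/-- The rotation by the angle `t` about the `k`-th axis. -/
def rot (k : Fin 3) (t : ℝ) : E3 ≃ₗᵢ[ℝ] E3 := orthIso (rotMat k t) (rotMat_orth k t)

lemma rot_apply (k : Fin 3) (t : ℝ) (x : E3) :
    rot k t x = x k • EuclideanSpace.single k (1 : ℝ)
      + (Real.cos t * x (k + 1) - Real.sin t * x (k + 2)) • EuclideanSpace.single (k + 1) (1 : ℝ)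
      + (Real.sin t * x (k + 1) + Real.cos t * x (k + 2)) •
        EuclideanSpace.single (k + 2) (1 : ℝ) := by
  obtain rfl | rfl | rfl : k = 0 ∨ k = 1 ∨ k = 2 := by lia
  all_goals
    ext i
    rw [rot, orthIso_apply]
    fin_cases i <;>
      simp [rotMat, Matrix.mulVec, dotProduct, Fin.sum_univ_three, fin3_add] <;> ring

lemma fin3_ne (k : Fin 3) : k ≠ k + 1 ∧ k ≠ k + 2 ∧ k + 1 ≠ k + 2 := by
  revert k
  decide

lemma rot_apply_add_one (k : Fin 3) (t : ℝ) (x : E3) :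
    rot k t x (k + 1) = Real.cos t * x (k + 1) - Real.sin t * x (k + 2) := by
  obtain ⟨h1, h2, h3⟩ := fin3_ne k
  rw [rot_apply]
  simp [h3, h1.symm]

lemma rot_apply_add_two (k : Fin 3) (t : ℝ) (x : E3) :
    rot k t x (k + 2) = Real.sin t * x (k + 1) + Real.cos t * x (k + 2) := by
  obtain ⟨h1, h2, h3⟩ := fin3_ne k
  rw [rot_apply]
  simp [h2.symm, h3.symm]

lemma rot_zero (k : Fin 3) (x : E3) : rot k 0 x = x := by
  rw [rot_apply]
  obtain rfl | rfl | rfl : k = 0 ∨ k = 1 ∨ k = 2 := by lia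
  all_goals
    ext i
    fin_cases i <;> simp [fin3_add]

lemma rot_two_pi (k : Fin 3) (x : E3) : rot k (2 * Real.pi) x = x := by
  conv_rhs => rw [← rot_zero k x]
  simp [rot_apply]

lemma rot_neg_rot (k : Fin 3) (t : ℝ) (x : E3) : rot k (-t) (rot k t x) = x := by
  have h := Real.sin_sq_add_cos_sq t
  have hk : rot k t x k = x k := by
    obtain ⟨h1, h2, h3⟩ := fin3_ne k
    rw [rot_apply]
    simp [h1, h2]
  conv_rhs => rw [← rot_zero k x]
  rw [rot_apply k (-t), rot_apply_add_one, rot_apply_add_two, rot_apply k 0, hk]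
  simp only [Real.cos_neg, Real.sin_neg, Real.cos_zero, Real.sin_zero]
  congr 2
  · congr 1
    linear_combination x (k + 1) * h
  · linear_combination x (k + 2) * h

lemma hasDerivAt_comp_rot {f : E3 → ℂ} (hf : SmoothOff f) (k : Fin 3) (t : ℝ) (x : E3) :
    HasDerivAt (fun s => f (rot k s x)) (ang k f (rot k t x)) t := by
  rcases eq_or_ne x 0 with rfl | hx
  · simpa [ang] using hasDerivAt_const t (f 0)
  have hc : HasDerivAt (fun s => rot k s x)
      ((-(rot k t x (k + 2))) • EuclideanSpace.single (k + 1) (1 : ℝ)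
        + (rot k t x (k + 1)) • EuclideanSpace.single (k + 2) (1 : ℝ)) t := by
    rw [rot_apply_add_one, rot_apply_add_two]
    have : (fun s => rot k s x) = fun s => _ := funext fun s => rot_apply k s x
    rw [this]
    have hcos := Real.hasDerivAt_cos t
    have hsin := Real.hasDerivAt_sin t
    refine (((((hcos.mul_const (x (k + 1))).sub (hsin.mul_const (x (k + 2)))).smul_const
      (EuclideanSpace.single (k + 1) (1 : ℝ) : E3)).const_add _).add
      (((hsin.mul_const (x (k + 1))).add (hcos.mul_const (x (k + 2)))).smul_const
      (EuclideanSpace.single (k + 2) (1 : ℝ) : E3))).congr_deriv ?_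
    congr 2 <;> ring
  refine (hasDerivAt_comp_curve hf hc (by simpa using hx)).congr_deriv ?_
  rw [← fderiv_apply_eq_sum, map_add, map_smul, map_smul, ang, pd, pd]
  simp only [Complex.real_smul, Complex.ofReal_neg]
  ring

end Rotations

section Algebra

open Module

variable {V : Type*} [AddCommGroup V] [Module ℂ V]

lemma lie_comm_apply {L : Fin 3 → End ℂ V}
    (hL : ∀ k, L k * L (k + 1) - L (k + 1) * L k = -L (k + 2)) (k : Fin 3) (w : V) :
    L k (L (k + 1) w) = L (k + 1) (L k w) - L (k + 2) w := by
  have := congrArg (fun T : End ℂ V => T w) (hL k)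
  simp only [LinearMap.sub_apply, Module.End.mul_apply, LinearMap.neg_apply] at this
  rw [sub_eq_iff_eq_add] at this
  rw [this]
  abel

lemma casimir_comm {L : Fin 3 → End ℂ V}
    (hL : ∀ k, L k * L (k + 1) - L (k + 1) * L k = -L (k + 2)) (k : Fin 3) (w : V) :
    (∑ j, L j * L j) (L k w) = L k ((∑ j, L j * L j) w) := by
  have c0 := lie_comm_apply hL 0
  have c1 := lie_comm_apply hL 1
  have c2 := lie_comm_apply hL 2
  simp only [fin3_add, zero_add] at c0 c1 c2
  obtain rfl | rfl | rfl : k = 0 ∨ k = 1 ∨ k = 2 := by lia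
  all_goals
    simp only [Fin.sum_univ_three, LinearMap.add_apply, Module.End.mul_apply, map_add, map_sub,
      c0, c1, c2]
    abel

variable [FiniteDimensional ℂ V]

/-- Eigenvalues of the Casimir element of a representation of the rotation Lie algebra in which
the weights are integral. -/
lemma casimir_eigenvalue (L : Fin 3 → End ℂ V)
    (hL : ∀ k, L k * L (k + 1) - L (k + 1) * L k = -L (k + 2))
    (hint : ∀ (μ : ℂ) (v : V), v ≠ 0 → L 2 v = μ • v → ∃ m : ℤ, μ = m * Complex.I)
    {c : ℂ} {v : V} (hv : v ≠ 0) (hc : (∑ k, L k * L k) v = c • v) :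
    ∃ l : ℕ, c = -(l * (l + 1)) := by
  have c0 := lie_comm_apply hL 0
  have c1 := lie_comm_apply hL 1
  have c2 := lie_comm_apply hL 2
  have hcomm := casimir_comm hL
  simp only [fin3_add, zero_add] at c0 c1 c2
  set C : End ℂ V := ∑ k, L k * L k with hC
  have hCw : ∀ w, C w = L 0 (L 0 w) + L 1 (L 1 w) + L 2 (L 2 w) := fun w => by
    simp [hC, Fin.sum_univ_three]
  let S : Set ℤ := {m | ∃ w, w ≠ 0 ∧ C w = c • w ∧ L 2 w = (m * Complex.I : ℂ) • w}
  have hS : S.Nonempty := by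
    let W := End.eigenspace C c
    have hW : ∀ w ∈ W, L 2 w ∈ W := fun w hw => by
      rw [End.mem_eigenspace_iff] at hw ⊢
      rw [hcomm, hw, map_smul]
    have : Nontrivial W := ⟨⟨⟨v, End.mem_eigenspace_iff.2 hc⟩, 0, fun h => hv (by
      simpa using congrArg Subtype.val h)⟩⟩
    obtain ⟨μ, hμ⟩ := End.exists_eigenvalue ((L 2).restrict hW)
    obtain ⟨w, hw⟩ := hμ.exists_hasEigenvector
    have hw1 : L 2 (w : V) = μ • (w : V) := congrArg Subtype.val hw.apply_eq_smul
    have hw0 : (w : V) ≠ 0 := by simpa using hw.2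
    obtain ⟨m, rfl⟩ := hint μ w hw0 hw1
    exact ⟨m, w, hw0, End.mem_eigenspace_iff.1 w.2, hw1⟩
  have hfin : S.Finite := by
    have h1 : {μ : ℂ | (L 2).HasEigenvalue μ}.Finite := End.finite_hasEigenvalue (L 2)
    refine Set.Finite.of_finite_image (f := fun m : ℤ => (m * Complex.I : ℂ)) (h1.subset ?_) ?_
    · rintro _ ⟨m, ⟨w, hw0, -, hw⟩, rfl⟩
      exact End.hasEigenvalue_of_hasEigenvector ⟨End.mem_eigenspace_iff.2 hw, hw0⟩
    · intro a _ b _ hab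
      simpa using hab
  obtain ⟨m, ⟨w, hw0, hwC, hw⟩, hmax⟩ := hfin.exists_maximal hS
  have hup : L 0 w + Complex.I • L 1 w = 0 := by
    by_contra hne
    have : m + 1 ∈ S := by
      refine ⟨_, hne, ?_, ?_⟩
      · rw [map_add, map_smul, hcomm, hcomm, hwC, map_smul, map_smul]
        module
      · have c1' : L 2 (L 1 w) = L 1 (L 2 w) + L 0 w := by rw [c1]; abel
        rw [map_add, map_smul, c2, c1', hw, map_smul, map_smul]
        push_cast
        match_scalars
        · ring_nf
        · ring_nf
          simp
    have := hmax this (by lia)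
    lia
  have h0 : L 0 w = -(Complex.I • L 1 w) := eq_neg_of_add_eq_zero_left hup
  have h1 : L 0 (L 0 w) + L 1 (L 1 w) = Complex.I • L 2 w := by
    rw [h0, map_neg, map_smul, c0, h0, map_neg, map_smul]
    match_scalars
    · ring_nf
      simp
    · ring
  have h2 : c • w = (-(m * (m + 1)) : ℂ) • w := by
    rw [← hwC, hCw, h1, hw, map_smul, hw]
    match_scalars
    ring_nf
    simp
    ring
  have h3 : c = -(m * (m + 1)) := smul_left_injective ℂ hw0 h2
  rcases le_or_gt 0 m with hm | hm
  · lift m to ℕ using hm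
    exact ⟨m, by simpa using h3⟩
  · obtain ⟨l, hl⟩ := Int.eq_ofNat_of_zero_le (by lia : 0 ≤ -m - 1)
    refine ⟨l, ?_⟩
    have : m = -l - 1 := by lia
    rw [h3, this]
    push_cast
    ring

end Algebra

section FiniteType

open Module MeasureTheory Filter Topology ComplexConjugate

/-- A finite-dimensional rotation-invariant space of eigenfunctions of the Schrödinger operator
which are bounded near the origin. -/
structure IsRotSol (γ : ℝ) (lam : ℂ) (V : Submodule ℂ (E3 → ℂ)) : Prop where
  finite : FiniteDimensional ℂ V
  smooth : ∀ f ∈ V, SmoothOff f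
  eig : ∀ f ∈ V, ∀ x, x ≠ 0 → Tsch γ f x = lam * f x
  bdd : ∀ f ∈ V, ∃ M : ℝ, ∀ x : E3, x ≠ 0 → ‖x‖ < 1 → ‖f x‖ ≤ M
  rot_mem : ∀ f ∈ V, ∀ k t, (fun x => f (rot k t x)) ∈ V

variable {γ : ℝ} {lam : ℂ} {V : Submodule ℂ (E3 → ℂ)}

lemma tendsto_rot_slope {f : E3 → ℂ} (hf : SmoothOff f) (k : Fin 3) :
    Tendsto (fun t : ℝ => (t : ℂ)⁻¹ • ((fun x => f (rot k t x)) - f)) (𝓝[≠] 0)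
      (𝓝 (ang k f)) := by
  rw [tendsto_pi_nhds]
  intro x
  have := hasDerivAt_iff_tendsto_slope_zero.1 (hasDerivAt_comp_rot hf k 0 x)
  simpa [rot_zero] using this

lemma IsRotSol.ang_mem (hV : IsRotSol γ lam V) {f : E3 → ℂ} (hf : f ∈ V) (k : Fin 3) :
    ang k f ∈ V := by
  have := hV.finite
  exact V.closed_of_finiteDimensional.mem_of_tendsto (tendsto_rot_slope (hV.smooth f hf) k)
    (Eventually.of_forall fun t => V.smul_mem _ (V.sub_mem (hV.rot_mem f hf k t) hf))

lemma pd_add {f g : E3 → ℂ} {x : E3} (hf : DifferentiableAt ℝ f x) (hg : DifferentiableAt ℝ g x)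
    (i : Fin 3) : pd i (f + g) x = pd i f x + pd i g x := by
  simp [pd, fderiv_add hf hg]

lemma pd_smul {f : E3 → ℂ} {x : E3} (hf : DifferentiableAt ℝ f x) (c : ℂ) (i : Fin 3) :
    pd i (c • f) x = c * pd i f x := by
  simp [pd, fderiv_const_smul hf c]

/-- The angular momentum operators as endomorphisms of a space of solutions. -/
def IsRotSol.angEnd (hV : IsRotSol γ lam V) (k : Fin 3) : End ℂ V where
  toFun f := ⟨ang k f, hV.ang_mem f.2 k⟩
  map_add' f g := by
    ext x
    rcases eq_or_ne x 0 with rfl | hx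
    · simp [ang]
    · have hf := (hV.smooth f f.2).differentiableAt hx
      have hg := (hV.smooth g g.2).differentiableAt hx
      simp only [Submodule.coe_add, ang, Pi.add_apply, pd_add hf hg]
      ring
  map_smul' c f := by
    ext x
    rcases eq_or_ne x 0 with rfl | hx
    · simp [ang]
    · have hf := (hV.smooth f f.2).differentiableAt hx
      simp only [Submodule.coe_smul, ang, Pi.smul_apply, pd_smul hf, RingHom.id_apply, smul_eq_mul]
      ring

@[simp]
lemma IsRotSol.coe_angEnd (hV : IsRotSol γ lam V) (k : Fin 3) (f : V) :
    (hV.angEnd k f : E3 → ℂ) = ang k f := rfl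

lemma IsRotSol.angEnd_commutator (hV : IsRotSol γ lam V) (k : Fin 3) :
    hV.angEnd k * hV.angEnd (k + 1) - hV.angEnd (k + 1) * hV.angEnd k = -hV.angEnd (k + 2) := by
  ext f x
  simpa using ang_commutator (x := x) (hV.smooth f f.2) k

lemma IsRotSol.weight_integral (hV : IsRotSol γ lam V) {μ : ℂ} {f : V} (hf : f ≠ 0)
    (hμ : hV.angEnd 2 f = μ • f) : ∃ m : ℤ, μ = m * Complex.I := by
  obtain ⟨x, hx⟩ : ∃ x, (f : E3 → ℂ) x ≠ 0 := by
    by_contra! h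
    exact hf (Subtype.ext (funext h))
  have hμ' : ∀ y, ang 2 f y = μ * (f : E3 → ℂ) y := fun y =>
    congrFun (congrArg Subtype.val hμ) y
  have hd : ∀ t : ℝ, HasDerivAt
      (fun s : ℝ => Complex.exp (-(μ * s)) * (f : E3 → ℂ) (rot 2 s x)) 0 t := fun t => by
    have h1 := hasDerivAt_comp_rot (hV.smooth f f.2) 2 t x
    have hid : HasDerivAt (fun s : ℝ => (s : ℂ)) 1 t := Complex.ofRealCLM.hasDerivAt
    refine (((hid.const_mul μ).fun_neg.cexp).mul h1).congr_deriv ?_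
    rw [hμ']
    ring
  have hconst := is_const_of_deriv_eq_zero (fun t => (hd t).differentiableAt)
    (fun t => (hd t).deriv) (2 * Real.pi) 0
  simp only [rot_two_pi, rot_zero, Complex.ofReal_zero, mul_zero, neg_zero, Complex.exp_zero]
    at hconst
  have h1 := mul_right_cancel₀ hx hconst
  obtain ⟨n, hn⟩ := Complex.exp_eq_one_iff.1 h1
  refine ⟨-n, ?_⟩
  have hpi : (2 * Real.pi : ℂ) ≠ 0 := by simp [Real.pi_ne_zero]
  apply mul_right_cancel₀ hpi
  push_cast at hn ⊢
  linear_combination -hn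

/-- The Casimir operator. -/
def IsRotSol.casimir (hV : IsRotSol γ lam V) : End ℂ V := ∑ k, hV.angEnd k * hV.angEnd k

lemma IsRotSol.casimir_apply (hV : IsRotSol γ lam V) (f : V) (x : E3) :
    (hV.casimir f : E3 → ℂ) x = ∑ k, ang k (ang k f) x := by
  simp [casimir]

/-- The sesquilinear pairing over a spherical shell. -/
def shellInner (ρ : ℝ) (f g : E3 → ℂ) : ℂ :=
  ∫ x in {x : E3 | ρ ≤ ‖x‖ ∧ ‖x‖ ≤ 2 * ρ}, conj (f x) * g x

lemma isCompact_shell (ρ : ℝ) : IsCompact {x : E3 | ρ ≤ ‖x‖ ∧ ‖x‖ ≤ 2 * ρ} := by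
  refine (isCompact_closedBall (0 : E3) (2 * ρ)).of_isClosed_subset ?_ fun x hx => by
    simpa using hx.2
  exact (isClosed_le continuous_const continuous_norm).inter
    (isClosed_le continuous_norm continuous_const)

lemma ne_zero_of_mem_shell {ρ : ℝ} (hρ : 0 < ρ) {x : E3} (hx : ρ ≤ ‖x‖ ∧ ‖x‖ ≤ 2 * ρ) : x ≠ 0 :=
  norm_pos_iff.1 (hρ.trans_le hx.1)

lemma integrableOn_shell {ρ : ℝ} (hρ : 0 < ρ) {f g : E3 → ℂ} (hf : SmoothOff f)
    (hg : SmoothOff g) : IntegrableOn (fun x => conj (f x) * g x)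
      {x : E3 | ρ ≤ ‖x‖ ∧ ‖x‖ ≤ 2 * ρ} := by
  refine ContinuousOn.integrableOn_compact (isCompact_shell ρ) ?_
  have hsub : {x : E3 | ρ ≤ ‖x‖ ∧ ‖x‖ ≤ 2 * ρ} ⊆ {x | x ≠ 0} :=
    fun x hx => ne_zero_of_mem_shell hρ hx
  exact ((Complex.continuous_conj.comp_continuousOn hf.continuousOn).mul hg.continuousOn).mono hsub

lemma shellInner_conj (ρ : ℝ) (f g : E3 → ℂ) : conj (shellInner ρ f g) = shellInner ρ g f := by
  rw [shellInner, shellInner, ← integral_conj]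
  simp [mul_comm]

lemma shellInner_rot (ρ : ℝ) (f g : E3 → ℂ) (k : Fin 3) (t : ℝ) :
    shellInner ρ f (fun x => g (rot k t x)) = shellInner ρ (fun x => f (rot k (-t) x)) g := by
  have hmp := (rot k t).measurePreserving
  have h := hmp.setIntegral_preimage_emb (rot k t).toHomeomorph.measurableEmbedding
    (fun x => conj (f (rot k (-t) x)) * g x) {x : E3 | ρ ≤ ‖x‖ ∧ ‖x‖ ≤ 2 * ρ}
  rw [shellInner, shellInner, ← h]
  simp [rot_neg_rot]

/-- Pairing on the right with elements of a space of solutions. -/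
def IsRotSol.shellRight (hV : IsRotSol γ lam V) {ρ : ℝ} (hρ : 0 < ρ) (f : V) : V →ₗ[ℂ] ℂ where
  toFun g := shellInner ρ f g
  map_add' g h := by
    have h1 := integrableOn_shell hρ (hV.smooth f f.2) (hV.smooth g g.2)
    have h2 := integrableOn_shell hρ (hV.smooth f f.2) (hV.smooth h h.2)
    simp only [shellInner, Submodule.coe_add, Pi.add_apply, mul_add]
    exact integral_add h1 h2
  map_smul' c g := by
    simp only [shellInner, Submodule.coe_smul, Pi.smul_apply, smul_eq_mul, RingHom.id_apply,
      ← integral_const_mul]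
    congr 1
    ext x
    ring

lemma IsRotSol.tendsto_slope (hV : IsRotSol γ lam V) (φ : V →ₗ[ℂ] ℂ) (f : V) (k : Fin 3) :
    Tendsto (fun t : ℝ => (t : ℂ)⁻¹ * (φ ⟨_, hV.rot_mem f f.2 k t⟩ - φ f)) (𝓝[≠] 0)
      (𝓝 (φ (hV.angEnd k f))) := by
  have := hV.finite
  have hφ : Continuous φ := φ.continuous_of_finiteDimensional
  have h : Tendsto (fun t : ℝ => (t : ℂ)⁻¹ • ((⟨_, hV.rot_mem f f.2 k t⟩ : V) - f)) (𝓝[≠] 0)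
      (𝓝 (hV.angEnd k f)) := by
    rw [tendsto_subtype_rng]
    exact tendsto_rot_slope (hV.smooth f f.2) k
  simpa [Function.comp_def] using (hφ.tendsto _).comp h

lemma IsRotSol.shellInner_ang (hV : IsRotSol γ lam V) {ρ : ℝ} (hρ : 0 < ρ) (f g : V)
    (k : Fin 3) : shellInner ρ (ang k f) g = -shellInner ρ f (ang k g) := by
  have h1 := hV.tendsto_slope (hV.shellRight hρ f) g k
  have h2 := hV.tendsto_slope (hV.shellRight hρ g) f k
  have hneg : Tendsto (fun t : ℝ => -t) (𝓝[≠] 0) (𝓝[≠] 0) := by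
    refine tendsto_nhdsWithin_iff.2 ⟨?_, ?_⟩
    · have : Tendsto (fun t : ℝ => -t) (𝓝 0) (𝓝 0) := by
        simpa using (continuous_neg (G := ℝ)).tendsto 0
      exact this.mono_left nhdsWithin_le_nhds
    · filter_upwards [self_mem_nhdsWithin] with t ht
      simpa using ht
  have h3 := ((Complex.continuous_conj.tendsto _).comp (h2.comp hneg)).neg
  have h4 := tendsto_nhds_unique h1 (h3.congr fun t => by
    simp only [Function.comp_apply, shellRight, LinearMap.coe_mk, AddHom.coe_mk, map_mul, map_sub,
      shellInner_conj, shellInner_rot]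
    simp)
  have h5 : shellInner ρ f (ang k g) = -conj (shellInner ρ g (ang k f)) := h4
  rw [h5, shellInner_conj, neg_neg]

lemma shellInner_self (ρ : ℝ) (f : E3 → ℂ) : shellInner ρ f f =
    ((∫ x in {x : E3 | ρ ≤ ‖x‖ ∧ ‖x‖ ≤ 2 * ρ}, ‖f x‖ ^ 2 : ℝ) : ℂ) := by
  rw [shellInner, ← integral_complex_ofReal]
  congr 1
  ext x
  rw [Complex.conj_mul']
  simp

lemma shellInner_self_re_nonneg (ρ : ℝ) (f : E3 → ℂ) : 0 ≤ (shellInner ρ f f).re := by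
  rw [shellInner_self, Complex.ofReal_re]
  positivity

lemma eq_zero_of_shellInner {f : E3 → ℂ} (hf : SmoothOff f)
    (h : ∀ ρ, 0 < ρ → (shellInner ρ f f).re = 0) {x : E3} (hx : x ≠ 0) : f x = 0 := by
  have hx' := norm_pos_iff.2 hx
  set ρ := 2 / 3 * ‖x‖ with hρdef
  have hρ : 0 < ρ := by positivity
  have h0 := h ρ hρ
  rw [shellInner_self, Complex.ofReal_re] at h0
  have hint : IntegrableOn (fun x => ‖f x‖ ^ 2) {x : E3 | ρ ≤ ‖x‖ ∧ ‖x‖ ≤ 2 * ρ} := by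
    have := (integrableOn_shell hρ hf hf).norm
    refine this.congr (Eventually.of_forall fun y => ?_)
    simp [sq]
  rw [setIntegral_eq_zero_iff_of_nonneg_ae (Eventually.of_forall fun y => by positivity) hint] at h0
  set U : Set E3 := {x : E3 | ρ < ‖x‖ ∧ ‖x‖ < 2 * ρ}
  have hU : IsOpen U := (isOpen_lt continuous_const continuous_norm).inter
    (isOpen_lt continuous_norm continuous_const)
  have hUs : U ⊆ {x : E3 | ρ ≤ ‖x‖ ∧ ‖x‖ ≤ 2 * ρ} := fun y hy => ⟨hy.1.le, hy.2.le⟩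
  have hae : (fun y => ‖f y‖ ^ 2) =ᵐ[volume.restrict U] fun _ => (0 : ℝ) :=
    ae_mono (Measure.restrict_mono hUs le_rfl) h0
  have heq := Measure.eqOn_open_of_ae_eq hae hU
    ((hf.continuousOn.mono fun y hy => ne_zero_of_mem_shell hρ (hUs hy)).norm.pow 2)
    continuousOn_const
  have hxU : x ∈ U := ⟨by linarith, by linarith⟩
  simpa using heq hxU

lemma IsRotSol.casimir_eigenvalue (hV : IsRotSol γ lam V) {c : ℂ}
    (hc : hV.casimir.HasEigenvalue c) : ∃ l : ℕ, c = -(l * (l + 1)) := by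
  have := hV.finite
  obtain ⟨v, hv⟩ := hc.exists_hasEigenvector
  exact _root_.casimir_eigenvalue hV.angEnd hV.angEnd_commutator
    (fun μ f hf h => hV.weight_integral hf h) hv.2 hv.apply_eq_smul

lemma IsRotSol.shellInner_casimir (hV : IsRotSol γ lam V) {ρ : ℝ} (hρ : 0 < ρ) (f g : V) :
    shellInner ρ (hV.casimir f) g = shellInner ρ f (hV.casimir g) := by
  have h1 : shellInner ρ f (hV.casimir g) = ∑ k, shellInner ρ f (ang k (ang k g)) := by
    change hV.shellRight hρ f (hV.casimir g) = _
    simp only [casimir, LinearMap.sum_apply, map_sum]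
    rfl
  have h2 : shellInner ρ g (hV.casimir f) = ∑ k, shellInner ρ g (ang k (ang k f)) := by
    change hV.shellRight hρ g (hV.casimir f) = _
    simp only [casimir, LinearMap.sum_apply, map_sum]
    rfl
  rw [← shellInner_conj, h2, h1, map_sum]
  refine Finset.sum_congr rfl fun k _ => ?_
  have a := hV.shellInner_ang hρ (hV.angEnd k f) g k
  have b := hV.shellInner_ang hρ f (hV.angEnd k g) k
  simp only [coe_angEnd] at a b
  rw [shellInner_conj, a, b, neg_neg]

end FiniteType

section Gradient

open Module Filter Topology

variable {γ : ℝ} {lam : ℂ} {V : Submodule ℂ (E3 → ℂ)}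

lemma ang_zero (k : Fin 3) (f : E3 → ℂ) : ang k f 0 = 0 := by simp [ang]

lemma IsRotSol.casimir_apply_zero (hV : IsRotSol γ lam V) (f : V) :
    (hV.casimir f : E3 → ℂ) 0 = 0 := by
  simp [hV.casimir_apply, ang_zero]

lemma IsRotSol.casimir_semisimple (hV : IsRotSol γ lam V) {c : ℝ} {v : V}
    (h : (hV.casimir - algebraMap ℂ _ (c : ℂ)) ((hV.casimir - algebraMap ℂ _ (c : ℂ)) v) = 0) :
    (hV.casimir - algebraMap ℂ _ (c : ℂ)) v = 0 := by
  set w := (hV.casimir - algebraMap ℂ _ (c : ℂ)) v with hw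
  have hw' : w = hV.casimir v - (c : ℂ) • v := by
    rw [hw, LinearMap.sub_apply, Module.algebraMap_end_apply]
  have hcw : hV.casimir w = (c : ℂ) • w := by
    rwa [LinearMap.sub_apply, Module.algebraMap_end_apply, sub_eq_zero] at h
  have hzero : ∀ x : E3, x ≠ 0 → (w : E3 → ℂ) x = 0 := fun x hx => by
    refine eq_zero_of_shellInner (hV.smooth w w.2) (fun ρ hρ => ?_) hx
    have h1 : shellInner ρ w w = shellInner ρ w (hV.casimir v) - c * shellInner ρ w v := by
      change hV.shellRight hρ w w = hV.shellRight hρ w (hV.casimir v) - c * hV.shellRight hρ w v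
      conv_lhs => rw [hw']
      rw [map_sub, map_smul, smul_eq_mul, ← hw']
    have h2 : shellInner ρ (hV.casimir w) v = c * shellInner ρ w v := by
      rw [hcw, ← shellInner_conj]
      change (starRingEnd ℂ) (hV.shellRight hρ v ((c : ℂ) • w)) = _
      rw [map_smul, smul_eq_mul, map_mul, Complex.conj_ofReal]
      change c * (starRingEnd ℂ) (shellInner ρ v w) = _
      rw [shellInner_conj]
    rw [h1, ← hV.shellInner_casimir hρ, h2]
    simp
  refine Subtype.ext (funext fun x => ?_)
  rcases eq_or_ne x 0 with rfl | hx
  · have h3 := congrFun (congrArg Subtype.val hcw) 0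
    have h4 := congrFun (congrArg Subtype.val hw') 0
    rw [hV.casimir_apply_zero] at h3
    simp only [Submodule.coe_sub, Submodule.coe_smul, Pi.sub_apply, Pi.smul_apply, smul_eq_mul,
      hV.casimir_apply_zero] at h3 h4
    rcases mul_eq_zero.1 h3.symm with h5 | h5
    · simpa [h5] using h4
    · simpa using h5
  · simpa using hzero x hx

lemma IsRotSol.iSup_eigenspace_casimir (hV : IsRotSol γ lam V) :
    ⨆ l : ℕ, hV.casimir.eigenspace (-(l * (l + 1) : ℂ)) = ⊤ := by
  have := hV.finite
  rw [eq_top_iff, ← Module.End.iSup_maxGenEigenspace_eq_top hV.casimir]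
  refine iSup_le fun μ => ?_
  rcases eq_or_ne (hV.casimir.eigenspace μ) ⊥ with hbot | hne
  · intro v hv
    obtain ⟨n, hn⟩ := (Module.End.mem_maxGenEigenspace _ _ _).1 hv
    rw [Module.End.eigenspace_def, LinearMap.ker_eq_bot] at hbot
    rw [Module.End.pow_apply] at hn
    have h0 := hbot.iterate n (hn.trans (iterate_map_zero _ n).symm)
    rw [h0]
    exact Submodule.zero_mem _
  · obtain ⟨l, rfl⟩ := hV.casimir_eigenvalue (c := μ) hne
    refine le_iSup_of_le l fun v hv => ?_
    obtain ⟨n, hn⟩ := (Module.End.mem_maxGenEigenspace _ _ _).1 hv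
    rw [Module.End.mem_eigenspace_iff]
    set c : ℝ := -(l * (l + 1)) with hc
    have hcc : (c : ℂ) = -(l * (l + 1)) := by simp [hc]
    rw [← hcc, ← Algebra.algebraMap_eq_smul_one] at hn
    rw [← hcc]
    have key : ∀ n : ℕ, ((hV.casimir - algebraMap ℂ _ (c : ℂ)) ^ n) v = 0 →
        (hV.casimir - algebraMap ℂ _ (c : ℂ)) v = 0 := by
      intro n
      induction n with
      | zero => intro h; simp at h; simp [h]
      | succ n ih =>
        intro h
        rcases n with _ | n
        · simpa using h
        · apply ih
          rw [pow_succ', Module.End.mul_apply]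
          rw [pow_succ', Module.End.mul_apply, pow_succ', Module.End.mul_apply] at h
          exact hV.casimir_semisimple h
    have h := key n hn
    rwa [LinearMap.sub_apply, Module.algebraMap_end_apply, sub_eq_zero] at h

lemma IsRotSol.ang_eq_zero (hV : IsRotSol γ lam V) {v : V} (h : hV.casimir v = 0) (k : Fin 3)
    (x : E3) : ang k v x = 0 := by
  rcases eq_or_ne x 0 with rfl | hx
  · exact ang_zero k _
  refine eq_zero_of_shellInner ((hV.smooth v v.2).ang k) (fun ρ hρ => ?_) hx
  have h1 : hV.shellRight hρ v (hV.casimir v) = 0 := by rw [h, map_zero]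
  have h2 : ∑ j, (shellInner ρ (ang j v) (ang j v)).re = 0 := by
    rw [← Complex.re_sum, ← neg_eq_zero, ← Complex.neg_re, ← Finset.sum_neg_distrib]
    have : ∑ j, -shellInner ρ (ang j v) (ang j v) = hV.shellRight hρ v (hV.casimir v) := by
      simp only [casimir, LinearMap.sum_apply, map_sum]
      refine Finset.sum_congr rfl fun j _ => ?_
      rw [neg_eq_iff_eq_neg]
      exact hV.shellInner_ang hρ v (hV.angEnd j v) j
    rw [this, h1, Complex.zero_re]
  exact (Finset.sum_eq_zero_iff_of_nonneg fun j _ => shellInner_self_re_nonneg ρ _).1 h2 k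
    (Finset.mem_univ k)

lemma hasDerivAt_radial {f : E3 → ℂ} (hf : SmoothOff f) {ω : E3} (hω : ω ≠ 0) {r : ℝ}
    (hr : 0 < r) :
    HasDerivAt (fun s : ℝ => f (s • ω)) (∑ i, (ω i : ℂ) * pd i f (r • ω)) r := by
  have hc : HasDerivAt (fun s : ℝ => s • ω) ω r := by
    simpa using (hasDerivAt_id r).smul_const ω
  exact hasDerivAt_comp_curve hf hc (smul_ne_zero hr.ne' hω)

lemma hasDerivAt_radial_deriv {f : E3 → ℂ} (hf : SmoothOff f) {ω : E3} (hω : ω ≠ 0) {r : ℝ}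
    (hr : 0 < r) :
    HasDerivAt (fun s : ℝ => ∑ i, (ω i : ℂ) * pd i f (s • ω))
      (∑ i, ∑ j, (ω i : ℂ) * ω j * pd i (pd j f) (r • ω)) r := by
  refine (HasDerivAt.fun_sum fun j (_ : j ∈ Finset.univ) =>
    (hasDerivAt_radial (hf.pd j) hω hr).const_mul (ω j : ℂ)).congr_deriv ?_
  rw [Finset.sum_comm]
  refine Finset.sum_congr rfl fun j _ => ?_
  rw [Finset.mul_sum]
  exact Finset.sum_congr rfl fun i _ => by ring

lemma Tsch_eq (γ : ℝ) (f : E3 → ℂ) (x : E3) :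
    Tsch γ f x = -(∑ i, pd i (pd i f) x) - ((2 * γ / ‖x‖ : ℝ) : ℂ) * f x := by
  simp [Tsch, Fin.sum_univ_three]

lemma radial_equation {f : E3 → ℂ} (hf : SmoothOff f)
    (heig : ∀ x, x ≠ 0 → Tsch γ f x = lam * f x) {c : ℂ}
    (hc : ∀ x, ∑ k, ang k (ang k f) x = -c * f x) {ω : E3} (hω : ‖ω‖ = 1) {r : ℝ} (hr : 0 < r) :
    (r : ℂ) ^ 2 * (∑ i, ∑ j, (ω i : ℂ) * ω j * pd i (pd j f) (r • ω))
      + 2 * r * (∑ i, (ω i : ℂ) * pd i f (r • ω))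
      = (c - 2 * γ * r - lam * r ^ 2) * f (r • ω) := by
  have hω0 : ω ≠ 0 := norm_ne_zero_iff.1 (by rw [hω]; exact one_ne_zero)
  have hx : r • ω ≠ 0 := smul_ne_zero hr.ne' hω0
  have hn : ‖r • ω‖ = r := by rw [norm_smul, hω, mul_one, Real.norm_of_nonneg hr.le]
  have h1 := sum_ang_ang hf hx
  have h2 := heig _ hx
  rw [hc, hn] at h1
  rw [Tsch_eq, hn] at h2
  have hrc : (r : ℂ) ≠ 0 := by exact_mod_cast hr.ne'
  push_cast at h2
  have h3 : (r : ℂ) ^ 2 * ∑ i, pd i (pd i f) (r • ω)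
      = -(2 * γ * r + lam * r ^ 2) * f (r • ω) := by
    have : ∑ i, pd i (pd i f) (r • ω) = -(2 * γ / r + lam) * f (r • ω) := by
      linear_combination -h2
    rw [this]
    field_simp
  have h4 : ∑ i, ∑ j, ((r • ω) i : ℂ) * (r • ω) j * pd i (pd j f) (r • ω)
      = (r : ℂ) ^ 2 * ∑ i, ∑ j, (ω i : ℂ) * ω j * pd i (pd j f) (r • ω) := by
    simp only [Finset.mul_sum]
    refine Finset.sum_congr rfl fun i _ => Finset.sum_congr rfl fun j _ => ?_
    simp only [PiLp.smul_apply, smul_eq_mul, Complex.ofReal_mul]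
    ring
  have h5 : ∑ i, ((r • ω) i : ℂ) * pd i f (r • ω) = r * ∑ i, (ω i : ℂ) * pd i f (r • ω) := by
    simp only [Finset.mul_sum]
    refine Finset.sum_congr rfl fun i _ => ?_
    simp only [PiLp.smul_apply, smul_eq_mul, Complex.ofReal_mul]
    ring
  rw [h4, h5, h3] at h1
  linear_combination h1

lemma exists_bound_sphere {f : E3 → ℂ} (hf : SmoothOff f) (c : ℂ) :
    ∃ W : ℝ, ∀ x : E3, ‖x‖ = 1 / 2 → ‖∑ i, (x i : ℂ) * pd i f x + c * f x‖ ≤ W := by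
  have hcont : ContinuousOn (fun x => ∑ i, (x i : ℂ) * pd i f x + c * f x) {x : E3 | x ≠ 0} :=
    (continuousOn_finsetSum _ fun i _ =>
      (contDiff_coord i).continuous.continuousOn.mul (hf.pd i).continuousOn).add
      (continuousOn_const.mul hf.continuousOn)
  obtain ⟨W, hW⟩ := (isCompact_sphere (0 : E3) (1 / 2)).exists_bound_of_continuousOn
    (hcont.mono fun x hx => norm_pos_iff.1 (by rw [mem_sphere_zero_iff_norm.1 hx]; norm_num))
  exact ⟨W, fun x hx => hW x (mem_sphere_zero_iff_norm.2 hx)⟩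

lemma exists_radial_bound (hγ : 0 < γ) {f : E3 → ℂ} (hf : SmoothOff f)
    (heig : ∀ x, x ≠ 0 → Tsch γ f x = lam * f x)
    (hbd : ∃ M : ℝ, ∀ x : E3, x ≠ 0 → ‖x‖ < 1 → ‖f x‖ ≤ M) {l : ℕ}
    (hl : ∀ x, ∑ k, ang k (ang k f) x = -(l * (l + 1)) * f x) :
    ∃ K : ℝ, ∀ x : E3, x ≠ 0 → ‖x‖ ≤ 1 / 2 →
      ‖∑ i, (x i : ℂ) * pd i f x‖ ≤ K * ‖x‖ ∧ (l ≠ 0 → ‖f x‖ ≤ K * ‖x‖) := by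
  obtain ⟨M, hM⟩ := hbd
  suffices h : ∃ K : ℝ, ∀ ω : E3, ‖ω‖ = 1 → ∀ r : ℝ, 0 < r → r ≤ 1 / 2 →
      ‖∑ i, (ω i : ℂ) * pd i f (r • ω)‖ ≤ K ∧ (l ≠ 0 → ‖f (r • ω)‖ ≤ K * r) by
    obtain ⟨K, hK⟩ := h
    refine ⟨K, fun x hx hx2 => ?_⟩
    have hpos := norm_pos_iff.2 hx
    obtain ⟨h1, h2⟩ := hK (‖x‖⁻¹ • x) (norm_smul_inv_norm (𝕜 := ℝ) hx) ‖x‖ hpos hx2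
    rw [smul_inv_smul₀ hpos.ne'] at h1 h2
    refine ⟨?_, h2⟩
    have h3 : ∑ i, (x i : ℂ) * pd i f x
        = ‖x‖ * ∑ i, ((‖x‖⁻¹ • x) i : ℂ) * pd i f x := by
      rw [Finset.mul_sum]
      refine Finset.sum_congr rfl fun i _ => ?_
      have : (‖x‖ : ℂ) ≠ 0 := by exact_mod_cast hpos.ne'
      simp only [PiLp.smul_apply, smul_eq_mul, Complex.ofReal_mul, Complex.ofReal_inv]
      field_simp
    rw [h3, norm_mul, Complex.norm_real, norm_norm, mul_comm]
    exact mul_le_mul_of_nonneg_right h1 hpos.le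
  have hn : ∀ ω : E3, ‖ω‖ = 1 → ∀ r : ℝ, 0 < r → ‖r • ω‖ = r := fun ω hω r hr => by
    rw [norm_smul, hω, mul_one, Real.norm_of_nonneg hr.le]
  have hω0 : ∀ ω : E3, ‖ω‖ = 1 → ω ≠ 0 := fun ω hω =>
    norm_ne_zero_iff.1 (by rw [hω]; exact one_ne_zero)
  have hMr : ∀ ω : E3, ‖ω‖ = 1 → ∀ r : ℝ, 0 < r → r < 1 → ‖f (r • ω)‖ ≤ M :=
    fun ω hω r hr hr1 => hM _ (smul_ne_zero hr.ne' (hω0 ω hω)) (by rwa [hn ω hω r hr])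
  rcases l with _ | n
  · refine ⟨(2 * γ + ‖lam‖) * M, fun ω hω r hr hr2 => ⟨?_, fun h => absurd rfl h⟩⟩
    exact norm_deriv_radial_zero_le hγ (fun r hr => hasDerivAt_radial hf (hω0 ω hω) hr)
      (fun r hr => hasDerivAt_radial_deriv hf (hω0 ω hω) hr)
      (fun r hr => radial_equation hf heig hl hω hr) (hMr ω hω) hr hr2
  · obtain ⟨W, hW⟩ := exists_bound_sphere hf ((n + 1 : ℕ) + 1)
    set K₁ := 2 * W + 2 * ((2 * γ + ‖lam‖) * M) with hK₁
    set K₂ := 2 * W + 2 * ((2 * γ + ‖lam‖) * K₁) with hK₂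
    have key : ∀ ω : E3, ‖ω‖ = 1 → ∀ r : ℝ, 0 < r → r ≤ 1 / 2 →
        ‖f (r • ω)‖ ≤ K₂ * r ∧ ‖∑ i, (ω i : ℂ) * pd i f (r • ω)‖ ≤ (n + 3) * K₂ := by
      intro ω hω r hr hr2
      refine norm_radial_succ_le (h := fun r => f (r • ω)) hγ
        (fun r hr => hasDerivAt_radial hf (hω0 ω hω) hr)
        (fun r hr => hasDerivAt_radial_deriv hf (hω0 ω hω) hr)
        (fun r hr => radial_equation hf heig hl hω hr) (hMr ω hω) ?_ rfl hK₁ hK₂ hr hr2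
      refine le_trans (le_of_eq ?_) (hW ((1 / 2 : ℝ) • ω) (hn ω hω _ (by norm_num)))
      congr 2
      rw [Finset.mul_sum]
      refine Finset.sum_congr rfl fun i _ => ?_
      simp only [PiLp.smul_apply, smul_eq_mul, Complex.ofReal_mul]
      ring
    refine ⟨(n + 3) * K₂, fun ω hω r hr hr2 => ⟨(key ω hω r hr hr2).2, fun _ => ?_⟩⟩
    have h := (key ω hω r hr hr2).1
    have hK : 0 ≤ K₂ * r := (norm_nonneg _).trans h
    nlinarith [mul_nonneg (n.cast_nonneg : (0 : ℝ) ≤ n) hK]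

/-- Boundedness near the origin, which is itself excluded. -/
abbrev BddNear (f : E3 → ℂ) : Prop := f =O[𝓝[≠] (0 : E3)] fun _ => (1 : ℝ)

lemma bddNear_iff {f : E3 → ℂ} : BddNear f ↔
    ∃ δ : ℝ, 0 < δ ∧ ∃ M : ℝ, ∀ x : E3, x ≠ 0 → ‖x‖ < δ → ‖f x‖ ≤ M := by
  rw [BddNear, Asymptotics.isBigO_iff]
  simp only [eventually_nhdsWithin_iff, Metric.eventually_nhds_iff, dist_zero_right, norm_one,
    mul_one]
  constructor
  · rintro ⟨M, δ, hδ, h⟩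
    exact ⟨δ, hδ, M, fun x hx hxδ => h hxδ hx⟩
  · rintro ⟨δ, hδ, M, h⟩
    exact ⟨M, δ, hδ, fun x hxδ hx => h x hx hxδ⟩

lemma isBigO_norm_of_bound {f : E3 → ℂ} {K : ℝ}
    (h : ∀ x : E3, x ≠ 0 → ‖x‖ ≤ 1 / 2 → ‖f x‖ ≤ K * ‖x‖) :
    f =O[𝓝[≠] (0 : E3)] fun x => ‖x‖ := by
  refine Asymptotics.IsBigO.of_bound K ?_
  filter_upwards [self_mem_nhdsWithin, nhdsWithin_le_nhds
    (Metric.closedBall_mem_nhds (0 : E3) (by norm_num : (0 : ℝ) < 1 / 2))] with x hx hx2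
  simpa using h x hx (by simpa using hx2)

lemma isBigO_coord (i : Fin 3) : (fun x : E3 => (x i : ℂ)) =O[𝓝[≠] (0 : E3)] fun x => ‖x‖ := by
  refine Asymptotics.isBigO_of_le _ fun x => ?_
  simpa using PiLp.norm_apply_le x i

lemma bddNear_pd {f : E3 → ℂ}
    (hrad : (fun x : E3 => ∑ i, (x i : ℂ) * pd i f x) =O[𝓝[≠] (0 : E3)] fun x => ‖x‖)
    (hang : ∀ k, ang k f =O[𝓝[≠] (0 : E3)] fun x => ‖x‖) (i : Fin 3) : BddNear (pd i f) := by
  have h : (fun x : E3 => (‖x‖ : ℂ) ^ 2 * pd i f x) =O[𝓝[≠] (0 : E3)] fun x => ‖x‖ * ‖x‖ := by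
    simp only [norm_sq_mul_pd]
    exact ((isBigO_coord i).mul hrad).add
      (((isBigO_coord _).mul (hang _)).sub ((isBigO_coord _).mul (hang _)))
  obtain ⟨K, hK⟩ := h.bound
  refine Asymptotics.IsBigO.of_bound K ?_
  filter_upwards [hK, self_mem_nhdsWithin] with x hx hx0
  have hpos : 0 < ‖x‖ * ‖x‖ := mul_self_pos.2 (norm_ne_zero_iff.2 hx0)
  rw [norm_mul, norm_pow, Complex.norm_real, norm_norm, sq, Real.norm_of_nonneg hpos.le,
    mul_comm K] at hx
  simpa using le_of_mul_le_mul_left hx hpos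

lemma IsRotSol.bddNear_pd_of_eigenvector (hγ : 0 < γ) (hV : IsRotSol γ lam V) {f : V} {l : ℕ}
    (hf : hV.casimir f = (-(l * (l + 1)) : ℂ) • f) (i : Fin 3) : BddNear (pd i f) := by
  have key : ∀ g : V, hV.casimir g = (-(l * (l + 1)) : ℂ) • g →
      ∃ K : ℝ, ∀ x : E3, x ≠ 0 → ‖x‖ ≤ 1 / 2 →
        ‖∑ i, (x i : ℂ) * pd i g x‖ ≤ K * ‖x‖ ∧ (l ≠ 0 → ‖(g : E3 → ℂ) x‖ ≤ K * ‖x‖) :=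
    fun g hg => exists_radial_bound hγ (hV.smooth g g.2) (hV.eig g g.2) (hV.bdd g g.2) fun x => by
      rw [← hV.casimir_apply, hg]
      rfl
  refine bddNear_pd ?_ (fun k => ?_) i
  · obtain ⟨K, hK⟩ := key f hf
    exact isBigO_norm_of_bound fun x hx hx2 => (hK x hx hx2).1
  · rcases eq_or_ne l 0 with rfl | hl
    · have h0 : ang k f = fun _ => 0 := funext fun x => hV.ang_eq_zero (by simpa using hf) k x
      rw [h0]
      exact Asymptotics.isBigO_zero _ _
    · have hk : hV.casimir (hV.angEnd k f) = (-(l * (l + 1)) : ℂ) • hV.angEnd k f := by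
        rw [← map_smul, ← hf]
        exact casimir_comm hV.angEnd_commutator k f
      obtain ⟨K, hK⟩ := key _ hk
      exact isBigO_norm_of_bound fun x hx hx2 => (hK x hx hx2).2 hl

lemma IsRotSol.bddNear_pd (hγ : 0 < γ) (hV : IsRotSol γ lam V) {f : E3 → ℂ} (hf : f ∈ V)
    (i : Fin 3) : BddNear (pd i f) := by
  let S : Submodule ℂ V :=
    { carrier := {g | BddNear (pd i g)}
      zero_mem' := by
        have : pd i (0 : E3 → ℂ) = fun _ => 0 := by
          ext x
          simp [pd]
        simp only [Set.mem_ofPred_eq, Submodule.coe_zero, this]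
        exact Asymptotics.isBigO_zero _ _
      add_mem' := fun {g h} hg hh => by
        refine (hg.add hh).congr' ?_ .rfl
        filter_upwards [self_mem_nhdsWithin] with x hx
        exact (pd_add ((hV.smooth g g.2).differentiableAt hx)
          ((hV.smooth h h.2).differentiableAt hx) i).symm
      smul_mem' := fun c g hg => by
        refine (hg.const_mul_left c).congr' ?_ .rfl
        filter_upwards [self_mem_nhdsWithin] with x hx
        exact (pd_smul ((hV.smooth g g.2).differentiableAt hx) c i).symm }
  have hS : S = ⊤ := by
    rw [eq_top_iff, ← hV.iSup_eigenspace_casimir]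
    exact iSup_le fun l g hg => hV.bddNear_pd_of_eigenvector hγ (Module.End.mem_eigenspace_iff.1 hg) i
  have : (⟨f, hf⟩ : V) ∈ S := hS ▸ Submodule.mem_top
  exact this

lemma bddNear_coord_div (γ : ℝ) {f : E3 → ℂ} (hf : BddNear f) (i : Fin 3) :
    BddNear fun x => ((γ * x i / ‖x‖ : ℝ) : ℂ) * f x := by
  have h1 : BddNear fun x : E3 => ((γ * x i / ‖x‖ : ℝ) : ℂ) := by
    refine Asymptotics.IsBigO.of_bound |γ| (Filter.Eventually.of_forall fun x => ?_)
    rw [Complex.norm_real, mul_div_assoc, norm_mul, Real.norm_eq_abs γ, norm_div, norm_norm, norm_one]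
    exact mul_le_mul_of_nonneg_left (div_le_one_of_le₀ (PiLp.norm_apply_le x i) (norm_nonneg x))
      (abs_nonneg γ)
  simpa using h1.mul hf

lemma IsRotSol.bddNear_ang_pd (hγ : 0 < γ) (hV : IsRotSol γ lam V) {f : E3 → ℂ} (hf : f ∈ V)
    (i k : Fin 3) : BddNear (ang k (pd i f)) := by
  have h : BddNear fun x => pd i (ang k f) x
      - ((if k + 1 = i then 1 else 0) * pd (k + 2) f x
        - (if k + 2 = i then 1 else 0) * pd (k + 1) f x) :=
    (hV.bddNear_pd hγ (hV.ang_mem hf k) i).sub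
      (((hV.bddNear_pd hγ hf _).const_mul_left _).sub ((hV.bddNear_pd hγ hf _).const_mul_left _))
  refine h.congr' ?_ .rfl
  filter_upwards [self_mem_nhdsWithin] with x hx
  exact (ang_pd (hV.smooth f hf) hx i k).symm

lemma IsRotSol.bddNear (hV : IsRotSol γ lam V) {f : E3 → ℂ} (hf : f ∈ V) : BddNear f := by
  obtain ⟨M, hM⟩ := hV.bdd f hf
  exact bddNear_iff.2 ⟨1, one_pos, M, hM⟩

lemma IsRotSol.bddNear_rungeLenz (hγ : 0 < γ) (hV : IsRotSol γ lam V) {f : E3 → ℂ} (hf : f ∈ V)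
    (i j k : Fin 3) : BddNear fun x => Complex.I * (ang k (pd j f) x - ang j (pd k f) x
      - pd i f x + ((γ * x i / ‖x‖ : ℝ) : ℂ) * f x) :=
  ((((hV.bddNear_ang_pd hγ hf j k).sub (hV.bddNear_ang_pd hγ hf k j)).sub
    (hV.bddNear_pd hγ hf i)).add (bddNear_coord_div γ (hV.bddNear hf) i)).const_mul_left _

end Gradient

section RotationSpan

open Matrix

lemma pd_congr {f g : E3 → ℂ} {x : E3} (h : f =ᶠ[nhds x] g) (i : Fin 3) : pd i f x = pd i g x := by
  simp only [pd, h.fderiv_eq]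

/-- The eigenfunctions of the Schrödinger operator which are bounded near the origin. -/
def boundedEigenfunctions (γ : ℝ) (lam : ℂ) : Submodule ℂ (E3 → ℂ) where
  carrier := {f | SmoothOff f ∧ (∀ x, x ≠ 0 → Tsch γ f x = lam * f x) ∧
    ∃ M : ℝ, ∀ x : E3, x ≠ 0 → ‖x‖ < 1 → ‖f x‖ ≤ M}
  zero_mem' := by
    have h : ∀ i, pd i (0 : E3 → ℂ) = 0 := fun i => by
      ext x
      simp [pd]
    exact ⟨contDiffOn_const, fun x _ => by simp [Tsch, h], 0, by simp⟩
  add_mem' := by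
    rintro f g ⟨hf, hf2, M, hM⟩ ⟨hg, hg2, N, hN⟩
    refine ⟨hf.add hg, fun x hx => ?_, M + N, fun x hx hx1 =>
      (norm_add_le _ _).trans (add_le_add (hM x hx hx1) (hN x hx hx1))⟩
    have h : ∀ i, pd i (pd i (f + g)) x = pd i (pd i f) x + pd i (pd i g) x := fun i => by
      rw [← pd_add ((hf.pd i).differentiableAt hx) ((hg.pd i).differentiableAt hx)]
      refine pd_congr ?_ i
      filter_upwards [isOpen_ne.mem_nhds hx] with y hy
      exact pd_add (hf.differentiableAt hy) (hg.differentiableAt hy) i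
    have h1 := hf2 x hx
    have h2 := hg2 x hx
    simp only [Tsch, h, Pi.add_apply] at h1 h2 ⊢
    linear_combination h1 + h2
  smul_mem' := by
    rintro c f ⟨hf, hf2, M, hM⟩
    refine ⟨contDiffOn_const.smul hf, fun x hx => ?_, ‖c‖ * M, fun x hx hx1 => ?_⟩
    · have h : ∀ i, pd i (pd i (c • f)) x = c * pd i (pd i f) x := fun i => by
        rw [← pd_smul ((hf.pd i).differentiableAt hx)]
        refine pd_congr ?_ i
        filter_upwards [isOpen_ne.mem_nhds hx] with y hy
        exact pd_smul (hf.differentiableAt hy) c i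
      have h1 := hf2 x hx
      simp only [Tsch, h, Pi.smul_apply, smul_eq_mul] at h1 ⊢
      linear_combination c * h1
    · rw [Pi.smul_apply, norm_smul]
      exact mul_le_mul_of_nonneg_left (hM x hx hx1) (norm_nonneg c)

lemma comp_isometry_mem {γ : ℝ} {lam : ℂ} {f : E3 → ℂ} (hf : f ∈ boundedEigenfunctions γ lam)
    (e : E3 ≃ₗᵢ[ℝ] E3) : f ∘ e ∈ boundedEigenfunctions γ lam := by
  obtain ⟨h1, h2, M, hM⟩ := hf
  refine ⟨h1.comp_isometry e, fun x hx => ?_, M, fun x hx hx1 =>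
    hM _ (by simpa using hx) (by simpa using hx1)⟩
  have h := h2 (e x) (by simpa using hx)
  rw [Tsch_eq, e.norm_map] at h
  rw [Tsch_eq, laplacian_comp_isometry h1 e hx]
  exact h

/-- The complex span of the rotations of a function. -/
abbrev rotationSpan (ψ : E3 → ℂ) : Submodule ℂ (E3 → ℂ) :=
  Submodule.span ℂ {g : E3 → ℂ | ∃ A : Matrix (Fin 3) (Fin 3) ℝ,
    A * A.transpose = 1 ∧ A.det = 1 ∧ g = rotate A ψ}

lemma rotate_eq_comp {A : Matrix (Fin 3) (Fin 3) ℝ} (hA : A * Aᵀ = 1) (ψ : E3 → ℂ) :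
    rotate A ψ = ψ ∘ orthIso Aᵀ (by rw [transpose_transpose]; exact mul_eq_one_comm.1 hA) := by
  ext x
  rw [rotate, inv_eq_right_inv hA]
  rfl

lemma self_mem_rotationSpan (ψ : E3 → ℂ) : ψ ∈ rotationSpan ψ :=
  Submodule.subset_span ⟨1, by simp, by simp, by ext x; simp [rotate]⟩

lemma rotationSpan_le {γ : ℝ} {lam : ℂ} {ψ : E3 → ℂ} (hψ : ψ ∈ boundedEigenfunctions γ lam) :
    rotationSpan ψ ≤ boundedEigenfunctions γ lam := by
  refine Submodule.span_le.2 ?_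
  rintro _ ⟨A, hA, -, rfl⟩
  rw [rotate_eq_comp hA]
  exact comp_isometry_mem hψ _

lemma comp_rot_mem_rotationSpan {ψ f : E3 → ℂ} (hf : f ∈ rotationSpan ψ) (k : Fin 3) (t : ℝ) :
    (fun x => f (rot k t x)) ∈ rotationSpan ψ := by
  suffices h : rotationSpan ψ ≤ (rotationSpan ψ).comap (LinearMap.funLeft ℂ ℂ (rot k t)) from h hf
  refine Submodule.span_le.2 ?_
  rintro _ ⟨A, hA, hA1, rfl⟩
  have hB := rotMat_orth k t
  have hB' := mul_eq_one_comm.1 hB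
  have hBA : ((rotMat k t)ᵀ * A) * ((rotMat k t)ᵀ * A)ᵀ = 1 := by
    rw [transpose_mul, transpose_transpose, Matrix.mul_assoc, ← Matrix.mul_assoc A, hA,
      Matrix.one_mul, hB']
  refine Submodule.subset_span ⟨(rotMat k t)ᵀ * A, hBA, ?_, ?_⟩
  · rw [det_mul, det_transpose, rotMat_det, hA1, one_mul]
  · ext x
    rw [rotate_eq_comp hBA, rotate_eq_comp hA]
    simp only [LinearMap.funLeft_apply, Function.comp_apply, rot, orthIso_apply, mulVec_mulVec,
      transpose_mul, transpose_transpose]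

lemma isRotSol_rotationSpan {γ : ℝ} {lam : ℂ} {ψ : E3 → ℂ}
    (hψ : ψ ∈ boundedEigenfunctions γ lam) (hfin : FiniteDimensional ℂ (rotationSpan ψ)) :
    IsRotSol γ lam (rotationSpan ψ) where
  finite := hfin
  smooth _ hf := (rotationSpan_le hψ hf).1
  eig _ hf := (rotationSpan_le hψ hf).2.1
  bdd _ hf := (rotationSpan_le hψ hf).2.2
  rot_mem _ hf k t := comp_rot_mem_rotationSpan hf k t

end RotationSpan

/-- The Runge–Lenz operators preserve the space of `K`-finite eigenfunctions of `T` that are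
bounded near the origin: if `ψ` is a smooth `λ`-eigenfunction of `T` on `ℝ³ ∖ {0}`, bounded
on the punctured unit ball, whose rotations under `SO(3)` span a finite-dimensional space,
then each `Rᵢψ` is bounded near the origin. -/
theorem runge_lenz_preserves_bounded_K_finite_eigenfunctions
    (γ : ℝ) (hγ : 0 < γ) (lam : ℂ)
    (ψ : E3 → ℂ) (hψ : ContDiffOn ℝ (⊤ : ℕ∞) ψ {x : E3 | x ≠ 0})
    (heig : ∀ x : E3, x ≠ 0 → Tsch γ ψ x = lam * ψ x)
    (hbd : ∃ M : ℝ, ∀ x : E3, x ≠ 0 → ‖x‖ < 1 → ‖ψ x‖ ≤ M)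
    (hKfin : FiniteDimensional ℂ
      (Submodule.span ℂ {g : E3 → ℂ | ∃ A : Matrix (Fin 3) (Fin 3) ℝ,
        A * A.transpose = 1 ∧ A.det = 1 ∧ g = rotate A ψ})) :
    (∃ δ : ℝ, 0 < δ ∧ ∃ M : ℝ, ∀ x : E3, x ≠ 0 → ‖x‖ < δ → ‖R1 γ ψ x‖ ≤ M) ∧
    (∃ δ : ℝ, 0 < δ ∧ ∃ M : ℝ, ∀ x : E3, x ≠ 0 → ‖x‖ < δ → ‖R2 γ ψ x‖ ≤ M) ∧
    (∃ δ : ℝ, 0 < δ ∧ ∃ M : ℝ, ∀ x : E3, x ≠ 0 → ‖x‖ < δ → ‖R3 γ ψ x‖ ≤ M) := by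
  have hV := isRotSol_rotationSpan (γ := γ) (lam := lam) ⟨hψ, heig, hbd⟩ hKfin
  have hmem := self_mem_rotationSpan ψ
  exact ⟨bddNear_iff.1 (hV.bddNear_rungeLenz hγ hmem 0 1 2),
    bddNear_iff.1 (hV.bddNear_rungeLenz hγ hmem 1 2 0),
    bddNear_iff.1 (hV.bddNear_rungeLenz hγ hmem 2 0 1)⟩
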